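/- arXiv:1602.05487 — 2 statements merged into one kernel-verified Lean document; each statement's English description precedes it below -/
import Mathlib

section
/- Let (X,d) be a metric space, I ⊂ ℝ a nonempty interval, and γ : I → X a piecewise locally Lipschitz curve. Then the length of γ satisfies L_d(γ) = ∫_I |γ̇|(t) dt, where |γ̇| is the metric derivative of γ (which exists almost everywhere). -/
open Filter Topology MeasureTheory Set
open scoped ENNReal NNReal Classical

section Defs

variable {X : Type*} [MetricSpace X]

/-- The metric derivative of the curve `γ` within the set `I` at the point `t` exists and has
value `L`, i.e. `lim_{s → t, s ∈ I} dist (γ s) (γ t) / |s - t| = L`. -/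
def HasMetricDerivWithinAt (γ : ℝ → X) (I : Set ℝ) (t : ℝ) (L : ℝ) : Prop :=
  Tendsto (fun s => dist (γ s) (γ t) / |s - t|) (𝓝[I \ {t}] t) (𝓝 L)

/-- The metric derivative `|γ̇|(t)` of `γ` within `I` at `t` (junk value `0` if the defining
limit does not exist). -/
noncomputable def metricDerivWithin (γ : ℝ → X) (I : Set ℝ) (t : ℝ) : ℝ :=
  if h : ∃ L, HasMetricDerivWithinAt γ I t L then h.choose else 0

/-- `γ` is locally Lipschitz on the set `s ⊆ ℝ`. -/
def LocallyLipschitzOnSet (γ : ℝ → X) (s : Set ℝ) : Prop :=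
  ∀ t ∈ s, ∃ ε > 0, ∃ C : NNReal, LipschitzOnWith C γ (s ∩ Metric.ball t ε)

/-- `γ` is a piecewise locally Lipschitz curve on the interval `I`: it is continuous on `I`
and locally Lipschitz outside finitely many points of `I` (equivalently, there are
`t_0 = inf I < t_1 < ⋯ < t_n = sup I` such that `γ` is locally Lipschitz on each
`I ∩ (t_i, t_(i+1))`). -/
def PiecewiseLocLipOn (γ : ℝ → X) (I : Set ℝ) : Prop :=
  ContinuousOn γ I ∧ ∃ S : Finset ℝ, LocallyLipschitzOnSet γ (I \ ↑S)

/-- The `K`-weighted length `L_K(γ) = ∫_I K (γ t) * |γ̇| t dt` of a curve `γ` defined on `I`. -/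
noncomputable def KLength (K : X → ℝ) (γ : ℝ → X) (I : Set ℝ) : ℝ≥0∞ :=
  ∫⁻ t in I, ENNReal.ofReal (K (γ t) * metricDerivWithin γ I t)

/-- The filter of approach to the left endpoint of the interval `I` (the endpoint may be
`-∞`, i.e. `I` may be unbounded below). -/
noncomputable def leftEndFilter (I : Set ℝ) : Filter ℝ :=
  if BddBelow I then 𝓝[I] (sInf I) else Filter.atBot ⊓ Filter.principal I

/-- The filter of approach to the right endpoint of the interval `I`. -/
noncomputable def rightEndFilter (I : Set ℝ) : Filter ℝ :=
  if BddAbove I then 𝓝[I] (sSup I) else Filter.atTop ⊓ Filter.principal I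

/-- `γ`, defined on the nonempty interval `I`, is a path from `x` to `y`: it is continuous on
`I` and converges to `x` (resp. `y`) at the left (resp. right) endpoint of `I` (where the
value at an infinite endpoint is understood as a limit). -/
def IsPathOn (γ : ℝ → X) (I : Set ℝ) (x y : X) : Prop :=
  I.Nonempty ∧ I.OrdConnected ∧ ContinuousOn γ I ∧
    Tendsto γ (leftEndFilter I) (𝓝 x) ∧ Tendsto γ (rightEndFilter I) (𝓝 y)

/-- The weighted (pseudo-)distance `d_K(x,y)`: the infimum of `L_K` over piecewise locally
Lipschitz paths from `x` to `y`. -/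
noncomputable def dK (K : X → ℝ) (x y : X) : ℝ≥0∞ :=
  ⨅ (γ : ℝ → X) (I : Set ℝ) (_ : PiecewiseLocLipOn γ I) (_ : IsPathOn γ I x y),
    KLength K γ I

/-- The intrinsic (geodesic) distance: the infimum of the length `L_d(γ) = eVariationOn γ I`
over all paths from `x` to `y`. -/
noncomputable def geodDist (x y : X) : ℝ≥0∞ :=
  ⨅ (γ : ℝ → X) (I : Set ℝ) (_ : IsPathOn γ I x y), eVariationOn γ I

/-- A length space: the distance coincides with the intrinsic distance. -/
def IsLengthSpace (Y : Type*) [MetricSpace Y] : Prop :=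
  ∀ x y : Y, geodDist x y = edist x y

/-- `K_r(x) := inf { K z : dist x z ≤ r }`. -/
noncomputable def Kinf (K : X → ℝ) (x : X) (r : ℝ) : ℝ :=
  sInf (K '' Metric.closedBall x r)

/-- `K^r(x) := sup { K z : dist x z ≤ r }`. -/
noncomputable def Ksup (K : X → ℝ) (x : X) (r : ℝ) : ℝ :=
  sSup (K '' Metric.closedBall x r)

/-- The energy `E_W(γ) = ∫_I (½ |γ̇|(t)² + W (γ t)) dt`. -/
noncomputable def energyW (W : X → ℝ) (γ : ℝ → X) (I : Set ℝ) : ℝ≥0∞ :=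
  ∫⁻ t in I, ENNReal.ofReal ((metricDerivWithin γ I t) ^ 2 / 2 + W (γ t))

end Defs

section MetricDeriv

variable {X : Type*} [MetricSpace X]

/-- A Lipschitz real function moves by at most the integral of the norm of its derivative. -/
lemma LipschitzWith.edist_le_lintegral_enorm_deriv {C : ℝ≥0} {φ : ℝ → ℝ} (hφ : LipschitzWith C φ)
    {a b : ℝ} (hab : a ≤ b) :
    edist (φ a) (φ b) ≤ ∫⁻ t in Ioc a b, ‖deriv φ t‖ₑ := by
  have hFTC := (hφ.lipschitzOnWith (s := uIcc a b)).absolutelyContinuousOnInterval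
    |>.integral_deriv_eq_sub
  rw [intervalIntegral.integral_of_le hab] at hFTC
  rw [edist_comm, edist_eq_enorm_sub, ← hFTC]
  exact enorm_integral_le_lintegral_enorm _

/-- If the distance between two points of a curve is controlled by the integral of `m` between the
corresponding times, then so is the length of the curve. -/
lemma eVariationOn_Icc_le_lintegral {γ : ℝ → X} {m : ℝ → ℝ≥0∞}
    (hm : ∀ s t, s ≤ t → edist (γ s) (γ t) ≤ ∫⁻ r in Ioc s t, m r) (a b : ℝ) :
    eVariationOn γ (Icc a b) ≤ ∫⁻ r in Ioc a b, m r := by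
  refine iSup_le fun ⟨n, u, hu, hmem⟩ => ?_
  have hsum : ∀ k, ∑ i ∈ Finset.range k, edist (γ (u (i + 1))) (γ (u i))
      ≤ ∫⁻ r in Ioc (u 0) (u k), m r := by
    intro k
    induction k with
    | zero => simp
    | succ k ih =>
      rw [Finset.sum_range_succ, edist_comm, ← Ioc_union_Ioc_eq_Ioc (hu (Nat.zero_le k))
        (hu k.le_succ), lintegral_union measurableSet_Ioc (Ioc_disjoint_Ioc_of_le le_rfl)]
      exact add_le_add ih (hm _ _ (hu k.le_succ))
  exact (hsum n).trans (lintegral_mono_set (Ioc_subset_Ioc (hmem 0).1 (hmem n).2))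

lemma LipschitzOnWith.eVariationOn_Icc_le {C : ℝ≥0} {γ : ℝ → X} {a b : ℝ}
    (hγ : LipschitzOnWith C γ (Icc a b)) :
    eVariationOn γ (Icc a b) ≤ C * ENNReal.ofReal (b - a) := by
  have h := hγ.comp_eVariationOn_le (g := id) (mapsTo_id _)
  rwa [eVariationOn_id_Icc] at h

/-- The variation between two times, for a Lipschitz curve, is the increment of the
variation function. -/
lemma LipschitzWith.ofReal_variationOnFromTo_sub {C : ℝ≥0} {γ : ℝ → X} (hγ : LipschitzWith C γ)
    {s t : ℝ} (hst : s ≤ t) :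
    ENNReal.ofReal (variationOnFromTo γ univ 0 t - variationOnFromTo γ univ 0 s)
      = eVariationOn γ (Icc s t) := by
  have hbv := hγ.locallyBoundedVariationOn univ
  rw [variationOnFromTo.sub_right hbv (mem_univ _) (mem_univ _) (mem_univ _),
    variationOnFromTo.eq_of_le _ _ hst, univ_inter, ENNReal.ofReal_toReal]
  exact ne_top_of_le_ne_top (by finiteness) (hγ.lipschitzOnWith.eVariationOn_Icc_le)

lemma LipschitzWith.monotone_variationOnFromTo {C : ℝ≥0} {γ : ℝ → X} (hγ : LipschitzWith C γ) :
    Monotone (variationOnFromTo γ univ 0) :=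
  monotoneOn_univ.1 (variationOnFromTo.monotoneOn (hγ.locallyBoundedVariationOn univ) (mem_univ 0))

lemma LipschitzWith.lipschitzWith_variationOnFromTo {C : ℝ≥0} {γ : ℝ → X}
    (hγ : LipschitzWith C γ) : LipschitzWith C (variationOnFromTo γ univ 0) := by
  have hle : ∀ s t, s ≤ t → edist (variationOnFromTo γ univ 0 s) (variationOnFromTo γ univ 0 t)
      ≤ C * edist s t := by
    intro s t hst
    rw [edist_comm, edist_dist, Real.dist_eq,
      abs_of_nonneg (sub_nonneg.2 (hγ.monotone_variationOnFromTo hst)),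
      hγ.ofReal_variationOnFromTo_sub hst, edist_comm, edist_dist, Real.dist_eq,
      abs_of_nonneg (sub_nonneg.2 hst)]
    exact hγ.lipschitzOnWith.eVariationOn_Icc_le
  intro s t
  rcases le_total s t with h | h
  · exact hle s t h
  · rw [edist_comm, edist_comm s]
    exact hle t s h

lemma LipschitzWith.dist_le_abs_variationOnFromTo_sub {C : ℝ≥0} {γ : ℝ → X}
    (hγ : LipschitzWith C γ) (s t : ℝ) :
    dist (γ s) (γ t) ≤ |variationOnFromTo γ univ 0 s - variationOnFromTo γ univ 0 t| := by
  wlog hst : t ≤ s generalizing s t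
  · rw [dist_comm, abs_sub_comm]
    exact this t s (le_of_not_ge hst)
  have h0 := sub_nonneg.2 (hγ.monotone_variationOnFromTo hst)
  rw [abs_of_nonneg h0, ← ENNReal.ofReal_le_ofReal_iff h0, ← edist_dist,
    hγ.ofReal_variationOnFromTo_sub hst]
  exact eVariationOn.edist_le γ (right_mem_Icc.2 hst) (left_mem_Icc.2 hst)

lemma LipschitzWith.eVariationOn_Icc_eq_lintegral_deriv {C : ℝ≥0} {γ : ℝ → X}
    (hγ : LipschitzWith C γ) {a b : ℝ} (hab : a ≤ b) :
    eVariationOn γ (Icc a b)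
      = ∫⁻ t in Ioc a b, ENNReal.ofReal (deriv (variationOnFromTo γ univ 0) t) := by
  have hac := (hγ.lipschitzWith_variationOnFromTo.lipschitzOnWith
    (s := uIcc a b)).absolutelyContinuousOnInterval
  have hFTC := hac.integral_deriv_eq_sub
  rw [intervalIntegral.integral_of_le hab] at hFTC
  rw [← hγ.ofReal_variationOnFromTo_sub hab, ← hFTC]
  refine ofReal_integral_eq_lintegral_ofReal ?_ ?_
  · exact (intervalIntegrable_iff_integrableOn_Ioc_of_le hab).1 hac.intervalIntegrable_deriv
  · exact ae_of_all _ fun t => hγ.monotone_variationOnFromTo.deriv_nonneg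

lemma HasDerivAt.tendsto_abs_sub_div {f : ℝ → ℝ} {f' t : ℝ} (hf : HasDerivAt f f' t) :
    Tendsto (fun s => |f s - f t| / |s - t|) (𝓝[≠] t) (𝓝 |f'|) := by
  have h := (hasDerivAt_iff_tendsto_slope.1 hf).abs
  refine h.congr fun s => ?_
  rw [slope_def_field, abs_div]

/-- A Lipschitz curve has, almost everywhere, a metric derivative, equal to the derivative of its
variation function. -/
lemma LipschitzWith.ae_hasMetricDerivWithinAt {C : ℝ≥0} {γ : ℝ → X} (hγ : LipschitzWith C γ)
    {a b : ℝ} (hab : a ≤ b) :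
    ∀ᵐ t ∂volume.restrict (Ioc a b),
      HasMetricDerivWithinAt γ univ t (deriv (variationOnFromTo γ univ 0) t) := by
  set V := variationOnFromTo γ univ 0
  let φ : ℚ → ℝ → ℝ := fun q t => dist (γ t) (γ q)
  have hφ : ∀ q, LipschitzWith C (φ q) := fun q => by
    have h := (LipschitzWith.dist_left (γ q)).comp hγ
    rwa [one_mul] at h
  have hφle : ∀ q s t, |φ q s - φ q t| ≤ dist (γ s) (γ t) := fun q s t =>
    abs_dist_sub_le _ _ _
  have hφV : ∀ q s t, |φ q s - φ q t| ≤ |V s - V t| := fun q s t =>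
    (hφle q s t).trans (hγ.dist_le_abs_variationOnFromTo_sub s t)
  let m : ℝ → ℝ≥0∞ := fun t => ⨆ q, ‖deriv (φ q) t‖ₑ
  have hdiff : ∀ᵐ t, DifferentiableAt ℝ V t ∧ ∀ q, DifferentiableAt ℝ (φ q) t :=
    hγ.lipschitzWith_variationOnFromTo.ae_differentiableAt_real.and
      (ae_all_iff.2 fun q => (hφ q).ae_differentiableAt_real)
  have hV0 : ∀ t, 0 ≤ deriv V t := fun t => hγ.monotone_variationOnFromTo.deriv_nonneg
  have hmV : ∀ᵐ t, m t ≤ ENNReal.ofReal (deriv V t) := by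
    filter_upwards [hdiff] with t ht
    refine iSup_le fun q => ?_
    rw [Real.enorm_eq_ofReal_abs]
    refine ENNReal.ofReal_le_ofReal ?_
    rw [← abs_of_nonneg (hV0 t)]
    refine le_of_tendsto_of_tendsto' (ht.2 q).hasDerivAt.tendsto_abs_sub_div
      ht.1.hasDerivAt.tendsto_abs_sub_div fun s => ?_
    exact div_le_div_of_nonneg_right (hφV q s t) (abs_nonneg _)
  have hedist : ∀ s t, s ≤ t → edist (γ s) (γ t) ≤ ∫⁻ r in Ioc s t, m r := by
    intro s t hst
    have hclosed : IsClosed {x : ℝ | edist (dist (γ s) (γ x)) (dist (γ t) (γ x))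
        ≤ ∫⁻ r in Ioc s t, m r} := by
      have := hγ.continuous
      exact isClosed_le (by fun_prop) continuous_const
    have hdense : DenseRange ((↑) : ℚ → ℝ) := Rat.denseRange_cast
    have hall := hdense.induction_on (p := fun x : ℝ =>
      edist (dist (γ s) (γ x)) (dist (γ t) (γ x)) ≤ ∫⁻ r in Ioc s t, m r) s hclosed fun q =>
        ((hφ q).edist_le_lintegral_enorm_deriv hst).trans
          (lintegral_mono fun r => le_iSup (fun q => ‖deriv (φ q) r‖ₑ) q)
    simpa [edist_dist, Real.dist_eq, dist_comm] using hall
  have hle := eVariationOn_Icc_le_lintegral hedist a b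
  have hEq := hγ.eVariationOn_Icc_eq_lintegral_deriv hab
  have hfin : ∫⁻ t in Ioc a b, m t ≠ ∞ := by
    refine ne_top_of_le_ne_top ?_ (lintegral_mono_ae (ae_restrict_of_ae hmV))
    rw [← hEq]
    exact ne_top_of_le_ne_top (by finiteness) (hγ.lipschitzOnWith.eVariationOn_Icc_le)
  have hae := ae_eq_of_ae_le_of_lintegral_le (ae_restrict_of_ae hmV) hfin
    (measurable_deriv V).ennreal_ofReal.aemeasurable (hEq ▸ hle)
  filter_upwards [hae, ae_restrict_of_ae hdiff] with t hmt ht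
  have huniv : (univ \ {t} : Set ℝ) = {t}ᶜ := (compl_eq_univ_sdiff _).symm
  rw [HasMetricDerivWithinAt, huniv, tendsto_order]
  constructor
  · intro c hc
    rcases lt_or_ge c 0 with hc0 | hc0
    · exact Eventually.of_forall fun s => hc0.trans_le (by positivity)
    have hlt : ENNReal.ofReal c < m t := by
      rw [hmt]
      exact (ENNReal.ofReal_lt_ofReal_iff (hc0.trans_lt hc)).2 hc
    obtain ⟨q, hq⟩ := lt_iSup_iff.1 hlt
    rw [Real.enorm_eq_ofReal_abs] at hq
    filter_upwards [(ht.2 q).hasDerivAt.tendsto_abs_sub_div.eventually_const_lt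
      (ENNReal.ofReal_lt_ofReal_iff_of_nonneg hc0 |>.1 hq)] with s hs
    refine hs.trans_le ?_
    exact div_le_div_of_nonneg_right (hφle q s t) (abs_nonneg _)
  · intro c hc
    rw [← abs_of_nonneg (hV0 t)] at hc
    filter_upwards [ht.1.hasDerivAt.tendsto_abs_sub_div.eventually_lt_const hc] with s hs
    refine lt_of_le_of_lt ?_ hs
    exact div_le_div_of_nonneg_right (hγ.dist_le_abs_variationOnFromTo_sub s t) (abs_nonneg _)

lemma HasMetricDerivWithinAt.metricDerivWithin_eq {γ : ℝ → X} {I : Set ℝ} {t L : ℝ}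
    (h : HasMetricDerivWithinAt γ I t L) [(𝓝[I \ {t}] t).NeBot] :
    metricDerivWithin γ I t = L := by
  have hex : ∃ L, HasMetricDerivWithinAt γ I t L := ⟨L, h⟩
  rw [metricDerivWithin, dif_pos hex]
  exact tendsto_nhds_unique hex.choose_spec h

/-- The metric derivative only depends on the germ of the curve. -/
lemma HasMetricDerivWithinAt.congr_of_mem_nhds {γ η : ℝ → X} {I U : Set ℝ} {t L : ℝ}
    (h : HasMetricDerivWithinAt η univ t L) (hU : U ∈ 𝓝 t) (heq : EqOn γ η U) :
    HasMetricDerivWithinAt γ I t L := by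
  have h' : HasMetricDerivWithinAt η I t L :=
    h.mono_left (nhdsWithin_mono _ (sdiff_subset_sdiff_left (subset_univ I)))
  refine Tendsto.congr' ?_ h'
  filter_upwards [mem_nhdsWithin_of_mem_nhds hU] with s hs
  rw [heq hs, heq (mem_of_mem_nhds hU)]

lemma LipschitzOnWith.eVariationOn_Icc_eq_lintegral_metricDerivWithin {C : ℝ≥0} {γ : ℝ → X}
    {I : Set ℝ} {a b : ℝ} (hab : a ≤ b) (hI : Icc a b ⊆ I)
    (hγ : LipschitzOnWith C γ (Icc a b)) :
    eVariationOn γ (Icc a b) = ∫⁻ t in Icc a b, ENNReal.ofReal (metricDerivWithin γ I t) := by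
  let η : ℝ → X := fun t => γ (projIcc a b hab t)
  have hη : LipschitzWith C η := by
    have h := hγ.to_restrict.comp (LipschitzWith.projIcc hab)
    rwa [mul_one] at h
  have heq : EqOn γ η (Icc a b) := fun t ht => by
    simp only [η, projIcc_of_mem hab ht]
  rw [eVariationOn.congr heq, hη.eVariationOn_Icc_eq_lintegral_deriv hab,
    setLIntegral_congr (Ioo_ae_eq_Icc (a := a) (b := b)).symm,
    setLIntegral_congr (Ioo_ae_eq_Ioc (a := a) (b := b)).symm]
  refine lintegral_congr_ae ?_
  have hae := ae_mono (Measure.restrict_mono Ioo_subset_Ioc_self le_rfl)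
    (hη.ae_hasMetricDerivWithinAt hab)
  filter_upwards [hae, ae_restrict_mem measurableSet_Ioo] with t ht htab
  have hmem : Icc a b ∈ 𝓝 t := Icc_mem_nhds htab.1 htab.2
  have : (𝓝[I \ {t}] t).NeBot := by
    rw [sdiff_eq, inter_comm, nhdsWithin_inter_of_mem' (nhdsWithin_le_nhds (mem_of_superset hmem hI))]
    infer_instance
  rw [(ht.congr_of_mem_nhds (I := I) hmem heq).metricDerivWithin_eq]

/-- The integral over an interval is the supremum of the integrals over its compact
subintervals. -/
lemma setLIntegral_le_of_forall_Icc {J : Set ℝ} (hJ : J.OrdConnected) {g : ℝ → ℝ≥0∞} {c : ℝ≥0∞}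
    (h : ∀ a ∈ J, ∀ b ∈ J, a ≤ b → ∫⁻ t in Icc a b, g t ≤ c) : ∫⁻ t in J, g t ≤ c := by
  let ι := {p : ℚ × ℚ // (p.1 : ℝ) ∈ J ∧ (p.2 : ℝ) ∈ J}
  let s : ι → Set ℝ := fun p => Icc (p.1.1 : ℝ) p.1.2
  have hdir : Directed (· ⊆ ·) s := by
    rintro ⟨⟨a, b⟩, ha, hb⟩ ⟨⟨a', b'⟩, ha', hb'⟩
    refine ⟨⟨(min a a', max b b'), ?_, ?_⟩, ?_, ?_⟩
    · rcases min_choice a a' with h | h <;> simp only [h] <;> assumption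
    · rcases max_choice b b' with h | h <;> simp only [h] <;> assumption
    · exact Icc_subset_Icc (by simp) (by simp)
    · exact Icc_subset_Icc (by simp) (by simp)
  have hint : interior J ⊆ ⋃ p, s p := by
    intro x hx
    obtain ⟨l, u, hxlu, hlu⟩ := mem_nhds_iff_exists_Ioo_subset.1 (mem_interior_iff_mem_nhds.1 hx)
    obtain ⟨p, hlp, hpx⟩ := exists_rat_btwn hxlu.1
    obtain ⟨q, hxq, hqu⟩ := exists_rat_btwn hxlu.2
    exact mem_iUnion.2 ⟨⟨(p, q), hlu ⟨hlp, hpx.trans hxlu.2⟩, hlu ⟨hxlu.1.trans hxq, hqu⟩⟩,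
      hpx.le, hxq.le⟩
  have hae : interior J =ᵐ[volume] J :=
    interior_ae_eq_of_null_frontier (hJ.convex.addHaar_frontier volume)
  rw [← setLIntegral_congr hae]
  refine (lintegral_mono_set hint).trans ?_
  rw [setLIntegral_iUnion_of_directed _ hdir]
  refine iSup_le fun ⟨p, hp⟩ => ?_
  rcases le_total (p.1 : ℝ) p.2 with hle | hle
  · exact h _ hp.1 _ hp.2 hle
  · rw [setLIntegral_measure_zero _ _ (by simp [s, hle])]
    exact zero_le

lemma LocallyLipschitzOnSet.mono {γ : ℝ → X} {s t : Set ℝ} (h : LocallyLipschitzOnSet γ t)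
    (hst : s ⊆ t) : LocallyLipschitzOnSet γ s := fun x hx => by
  obtain ⟨ε, hε, C, hC⟩ := h x (hst hx)
  exact ⟨ε, hε, C, hC.mono (inter_subset_inter_left _ hst)⟩

lemma LocallyLipschitzOnSet.locallyLipschitzOn {γ : ℝ → X} {s : Set ℝ}
    (h : LocallyLipschitzOnSet γ s) : LocallyLipschitzOn s γ := fun x hx => by
  obtain ⟨ε, hε, C, hC⟩ := h x hx
  exact ⟨C, _, inter_mem_nhdsWithin s (Metric.ball_mem_nhds x hε), hC⟩

lemma LocallyLipschitzOnSet.eVariationOn_eq_lintegral {γ : ℝ → X} {I J : Set ℝ}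
    (hJ : J.OrdConnected) (hJI : J ⊆ I) (hγ : LocallyLipschitzOnSet γ J) :
    eVariationOn γ J = ∫⁻ t in J, ENNReal.ofReal (metricDerivWithin γ I t) := by
  have hIcc : ∀ a ∈ J, ∀ b ∈ J, a ≤ b → eVariationOn γ (Icc a b)
      = ∫⁻ t in Icc a b, ENNReal.ofReal (metricDerivWithin γ I t) := by
    intro a ha b hb hab
    have hsub := hJ.out ha hb
    obtain ⟨C, hC⟩ :=
      (hγ.mono hsub).locallyLipschitzOn.exists_lipschitzOnWith_of_compact isCompact_Icc
    exact hC.eVariationOn_Icc_eq_lintegral_metricDerivWithin hab (hsub.trans hJI)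
  apply le_antisymm
  · rw [eVariationOn.eq_biSup_inter_Icc]
    refine iSup₂_le fun p hp => ?_
    have hsub := hJ.out hp.1 hp.2.1
    rw [inter_eq_self_of_subset_right hsub, hIcc _ hp.1 _ hp.2.1 hp.2.2]
    exact lintegral_mono_set hsub
  · refine setLIntegral_le_of_forall_Icc hJ fun a ha b hb hab => ?_
    rw [← hIcc a ha b hb hab]
    exact eVariationOn.mono γ (hJ.out ha hb)

/-- Removing a point from an interval does not change the length of a continuous
curve. -/
lemma ContinuousOn.eVariationOn_eq_Iio_add_Ioi {γ : ℝ → X} {J : Set ℝ} (hγ : ContinuousOn γ J)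
    (hJ : J.OrdConnected) {c : ℝ} (hc : c ∈ J) :
    eVariationOn γ J = eVariationOn γ (J ∩ Iio c) + eVariationOn γ (J ∩ Ioi c) := by
  have hunion : J = (J ∩ Iic c) ∪ (J ∩ Ici c) := by
    rw [← inter_union_distrib_left, Iic_union_Ici, inter_univ]
  have hleft : eVariationOn γ (J ∩ Iio c) = eVariationOn γ (J ∩ Iic c) := by
    rcases (J ∩ Iio c).eq_empty_or_nonempty with h | ⟨x, hxJ, hxc⟩
    · have hsub : (J ∩ Iic c).Subsingleton := by
        refine subsingleton_singleton.anti (t := {c}) fun y hy => ?_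
        by_contra hne
        exact h.subset ⟨hy.1, lt_of_le_of_ne hy.2 hne⟩
      rw [h, eVariationOn.subsingleton γ hsub, eVariationOn.subsingleton γ subsingleton_empty]
    · refine eVariationOn.eVariationOn_inter_Iio_eq_inter_Iic_of_continuousWithinAt ?_
        ((hγ c hc).mono inter_subset_left)
      refine (inferInstance : (𝓝[<] c).NeBot).mono ?_
      rw [← nhdsWithin_Ico_eq_nhdsLT hxc]
      exact nhdsWithin_mono _ fun y hy => ⟨hJ.out hxJ hc ⟨hy.1, hy.2.le⟩, hy.2⟩
  have hright : eVariationOn γ (J ∩ Ioi c) = eVariationOn γ (J ∩ Ici c) := by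
    rcases (J ∩ Ioi c).eq_empty_or_nonempty with h | ⟨x, hxJ, hxc⟩
    · have hsub : (J ∩ Ici c).Subsingleton := by
        refine subsingleton_singleton.anti (t := {c}) fun y hy => ?_
        by_contra hne
        exact h.subset ⟨hy.1, lt_of_le_of_ne hy.2 (Ne.symm hne)⟩
      rw [h, eVariationOn.subsingleton γ hsub, eVariationOn.subsingleton γ subsingleton_empty]
    · refine eVariationOn.eVariationOn_inter_Ioi_eq_inter_Ici_of_continuousWithinAt ?_
        ((hγ c hc).mono inter_subset_left)
      refine (inferInstance : (𝓝[>] c).NeBot).mono ?_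
      rw [← nhdsWithin_Ioc_eq_nhdsGT hxc]
      exact nhdsWithin_mono _ fun y hy => ⟨hJ.out hc hxJ ⟨hy.1.le, hy.2⟩, hy.1⟩
  rw [hleft, hright]
  conv_lhs => rw [hunion]
  exact eVariationOn.union γ ⟨⟨hc, self_mem_Iic⟩, fun y hy => hy.2⟩
    ⟨⟨hc, self_mem_Ici⟩, fun y hy => hy.2⟩

lemma setLIntegral_eq_Iio_add_Ioi {J : Set ℝ} (hJ : J.OrdConnected) (g : ℝ → ℝ≥0∞) (c : ℝ) :
    ∫⁻ t in J, g t = (∫⁻ t in J ∩ Iio c, g t) + ∫⁻ t in J ∩ Ioi c, g t := by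
  have hdisj : Disjoint (J ∩ Iio c) (J ∩ Ioi c) :=
    disjoint_left.2 fun x hx hx' => lt_asymm (mem_Iio.1 hx.2) (mem_Ioi.1 hx'.2)
  rw [← lintegral_union (hJ.measurableSet.inter measurableSet_Ioi) hdisj,
    ← inter_union_distrib_left, Iio_union_Ioi, ← sdiff_eq]
  exact setLIntegral_congr (sdiff_null_ae_eq_self (measure_singleton c)).symm

/-- The length formula on a subinterval `J` of `I`, the metric derivative being taken within
`I`. -/
lemma eVariationOn_eq_lintegral_of_finset {γ : ℝ → X} {I : Set ℝ} (S : Finset ℝ) :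
    ∀ J : Set ℝ, J.OrdConnected → J ⊆ I → ContinuousOn γ J → LocallyLipschitzOnSet γ (J \ ↑S) →
      eVariationOn γ J = ∫⁻ t in J, ENNReal.ofReal (metricDerivWithin γ I t) := by
  induction S using Finset.induction_on with
  | empty =>
    intro J hJ hJI _ hlip
    rw [Finset.coe_empty, sdiff_empty] at hlip
    exact hlip.eVariationOn_eq_lintegral hJ hJI
  | insert c S _ ih =>
    intro J hJ hJI hcont hlip
    rw [Finset.coe_insert] at hlip
    by_cases hc : c ∈ J
    · rw [hcont.eVariationOn_eq_Iio_add_Ioi hJ hc, setLIntegral_eq_Iio_add_Ioi hJ _ c,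
        ih (J ∩ Iio c) (hJ.inter ordConnected_Iio) (inter_subset_left.trans hJI)
          (hcont.mono inter_subset_left) (hlip.mono ?_),
        ih (J ∩ Ioi c) (hJ.inter ordConnected_Ioi) (inter_subset_left.trans hJI)
          (hcont.mono inter_subset_left) (hlip.mono ?_)]
      · exact fun x hx => ⟨hx.1.1, fun h => h.elim (ne_of_gt hx.1.2) hx.2⟩
      · exact fun x hx => ⟨hx.1.1, fun h => h.elim (ne_of_lt hx.1.2) hx.2⟩
    · refine ih J hJ hJI hcont (hlip.mono fun x hx => ⟨hx.1, fun h => h.elim ?_ hx.2⟩)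
      rintro rfl
      exact hc hx.1

end MetricDeriv

/-- For a piecewise locally Lipschitz curve `γ` on a nonempty interval `I`, the
length of `γ` equals the integral of its metric derivative: `L_d(γ) = ∫_I |γ̇|(t) dt`. -/
theorem length_eq_integral_metricDeriv
    {X : Type*} [MetricSpace X] (I : Set ℝ) (hne : I.Nonempty) (hint : I.OrdConnected)
    (γ : ℝ → X) (hγ : PiecewiseLocLipOn γ I) :
    eVariationOn γ I = ∫⁻ t in I, ENNReal.ofReal (metricDerivWithin γ I t) := by
  obtain ⟨hcont, S, hlip⟩ := hγ
  exact eVariationOn_eq_lintegral_of_finset S I hint subset_rfl hcont hlip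
end

section
/- Let (X,d) be a proper length metric space, K : X → [0,∞) continuous with Σ := {K = 0} finite, and suppose K(x) ≥ k(d(x,Σ)) for some continuous k : [0,∞) → [0,∞) with ∫_0^∞ k(t) dt = +∞. Then on every d-compact subset Y ⊂ X, the metrics d and d_K are topologically equivalent: the identity map from (Y, d) to (Y, d_K) is a homeomorphism. -/
open Filter Topology MeasureTheory Set
open scoped ENNReal NNReal Classical

/-- **Metric Rademacher theorem** in dimension one: a Lipschitz curve in a metric space has a
metric derivative almost everywhere. -/
theorem LipschitzWith.ae_exists_metricDeriv {X : Type*} [MetricSpace X] {γ : ℝ → X} {C : ℝ≥0}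
    (hγ : LipschitzWith C γ) :
    ∀ᵐ t, ∃ L, Tendsto (fun s => dist (γ s) (γ t) / |s - t|) (𝓝[≠] t) (𝓝 L) := by
  let g : ℚ → ℝ → ℝ := fun q t => dist (γ t) (γ q)
  have hg : ∀ q, LipschitzWith C (g q) := fun q => by
    have := (LipschitzWith.dist_left (γ q)).comp hγ
    rwa [one_mul] at this
  let m : ℝ → ℝ := fun t => ⨆ q, ‖deriv (g q) t‖
  have hbdd : ∀ t, BddAbove (range fun q => ‖deriv (g q) t‖) := fun t =>
    ⟨C, by rintro _ ⟨q, rfl⟩; exact norm_deriv_le_of_lipschitz (hg q)⟩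
  have hle : ∀ q t, ‖deriv (g q) t‖ ≤ m t := fun q t => le_ciSup (hbdd t) q
  have hm0 : ∀ t, 0 ≤ m t := fun t => (norm_nonneg _).trans (hle 0 t)
  have hmC : ∀ t, ‖m t‖ ≤ C := fun t => by
    rw [Real.norm_of_nonneg (hm0 t)]
    exact ciSup_le fun q => norm_deriv_le_of_lipschitz (hg q)
  have hmeas : Measurable m := Measurable.iSup fun q => (measurable_deriv (g q)).norm
  have hmloc : LocallyIntegrable m volume :=
    (locallyIntegrable_const (C : ℝ)).mono hmeas.aestronglyMeasurable
      (Eventually.of_forall fun t => by simpa using hmC t)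
  have hmint : ∀ a b, IntervalIntegrable m volume a b := fun a b =>
    (hmloc.integrableOn_isCompact isCompact_uIcc).intervalIntegrable
  let F : ℝ → ℝ := fun t => ∫ u in (0 : ℝ)..t, m u
  have hFsub : ∀ s t, F s - F t = ∫ u in t..s, m u := fun s t =>
    intervalIntegral.integral_interval_sub_left (hmint 0 s) (hmint 0 t)
  have hgF : ∀ q s t, |g q s - g q t| ≤ |F s - F t| := fun q s t => by
    have hac : AbsolutelyContinuousOnInterval (g q) t s :=
      (hg q).lipschitzOnWith.absolutelyContinuousOnInterval
    rw [hFsub, ← hac.integral_deriv_eq_sub]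
    exact intervalIntegral.norm_integral_le_abs_of_norm_le
      (Eventually.of_forall fun u => hle q u) (hmint t s)
  have hdF : ∀ s t, dist (γ s) (γ t) ≤ |F s - F t| := fun s t => by
    have hcont : Continuous fun u : ℝ => |dist (γ s) (γ u) - dist (γ t) (γ u)| := by
      have := hγ.continuous
      fun_prop
    have hcl : IsClosed {u : ℝ | |dist (γ s) (γ u) - dist (γ t) (γ u)| ≤ |F s - F t|} :=
      isClosed_le hcont continuous_const
    have hmem : t ∈ {u : ℝ | |dist (γ s) (γ u) - dist (γ t) (γ u)| ≤ |F s - F t|} := by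
      have hd : closure (range ((↑) : ℚ → ℝ)) ⊆ _ :=
        closure_minimal (by rintro _ ⟨q, rfl⟩; exact hgF q s t) hcl
      exact hd (Rat.denseRange_cast t)
    simpa using hmem
  have hdiff : ∀ᵐ t, ∀ q, DifferentiableAt ℝ (g q) t :=
    ae_all_iff.2 fun q => (hg q).ae_differentiableAt_real
  filter_upwards [LocallyIntegrable.ae_hasDerivAt_integral hmloc, hdiff] with t hF hd
  refine ⟨m t, tendsto_order.2 ⟨fun a ha => ?_, fun a ha => ?_⟩⟩
  · obtain ⟨q, hq⟩ := exists_lt_of_lt_ciSup ha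
    have hs := (hasDerivAt_iff_tendsto_slope.1 (hd q).hasDerivAt).norm
    filter_upwards [hs.eventually_const_lt hq] with s hs
    refine hs.trans_le ?_
    rw [slope_def_field, norm_div, Real.norm_eq_abs, Real.norm_eq_abs]
    gcongr
    exact abs_dist_sub_le _ _ _
  · have hs := (hasDerivAt_iff_tendsto_slope.1 (hF 0)).norm
    rw [Real.norm_of_nonneg (hm0 t)] at hs
    filter_upwards [hs.eventually_lt_const ha] with s hs
    refine lt_of_le_of_lt ?_ hs
    rw [slope_def_field, norm_div, Real.norm_eq_abs, Real.norm_eq_abs]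
    gcongr
    exact hdF s t

/-- A curve that is locally Lipschitz off a finite set has a metric derivative almost everywhere
in any open interval contained in its domain. -/
theorem LocallyLipschitzOnSet.ae_exists_hasMetricDerivWithinAt {X : Type*} [MetricSpace X]
    {γ : ℝ → X} {I : Set ℝ} {S : Finset ℝ} (hγ : LocallyLipschitzOnSet γ (I \ S)) {a b : ℝ}
    (hab : Ioo a b ⊆ I) :
    ∀ᵐ t, t ∈ Ioo a b → ∃ L, HasMetricDerivWithinAt γ I t L := by
  have hnull : volume
      {t | t ∈ Ioo a b \ (S : Set ℝ) ∧ ¬ ∃ L, HasMetricDerivWithinAt γ I t L} = 0 := by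
    refine measure_null_of_locally_null _ fun t ⟨ht, _⟩ => ?_
    have hopen : IsOpen (Ioo a b \ (S : Set ℝ)) := isOpen_Ioo.sdiff S.finite_toSet.isClosed
    obtain ⟨ε, hε, C, hC⟩ := hγ t ⟨hab ht.1, ht.2⟩
    obtain ⟨r, hr, hball⟩ := Metric.nhds_basis_closedBall.mem_iff.1
      (inter_mem (hopen.mem_nhds ht) (Metric.ball_mem_nhds t hε))
    rw [Real.closedBall_eq_Icc] at hball
    have hle : t - r ≤ t + r := by linarith
    have hLip : LipschitzOnWith C γ (Icc (t - r) (t + r)) :=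
      hC.mono fun s hs => ⟨⟨hab (hball hs).1.1, (hball hs).1.2⟩, (hball hs).2⟩
    have hext : LipschitzWith C (fun s => γ (projIcc (t - r) (t + r) hle s)) := by
      have := hLip.to_restrict.comp (LipschitzWith.projIcc hle)
      rwa [mul_one] at this
    refine ⟨_, inter_mem_nhdsWithin _ (Ioo_mem_nhds (sub_lt_self t hr) (lt_add_of_pos_right t hr)),
      measure_mono_null ?_ hext.ae_exists_metricDeriv⟩
    rintro s ⟨⟨hs, hn⟩, hsr⟩ ⟨L, hL⟩
    refine hn ⟨L, ?_⟩
    refine Tendsto.congr' ?_ (hL.mono_left (nhdsWithin_mono s fun u hu => hu.2))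
    filter_upwards [mem_nhdsWithin_of_mem_nhds (Icc_mem_nhds hsr.1 hsr.2)] with u hu
    rw [projIcc_of_mem hle hu, projIcc_of_mem hle (Ioo_subset_Icc_self hsr)]
  have hS : ∀ᵐ t : ℝ, t ∉ (S : Set ℝ) := S.finite_toSet.countable.ae_notMem volume
  filter_upwards [measure_eq_zero_iff_ae_notMem.1 hnull, hS] with t ht htS htab
  by_contra hn
  exact ht ⟨⟨htab, htS⟩, hn⟩

/-- For a continuous function that is locally Lipschitz off a finite set, the increment is bounded
by the integral of the absolute value of the derivative. -/
theorem enorm_sub_le_lintegral_enorm_deriv {f : ℝ → ℝ} (S : Finset ℝ) {a b : ℝ} (hab : a ≤ b)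
    (hc : ContinuousOn f (Icc a b)) (hf : LocallyLipschitzOn (Ioo a b \ S) f) :
    ‖f b - f a‖ₑ ≤ ∫⁻ t in Ioc a b, ‖deriv f t‖ₑ := by
  induction S using Finset.induction_on generalizing a b with
  | empty =>
    rcases hab.eq_or_lt with rfl | hab'
    · simp
    have key : ∀ p ∈ Ioo a b, ∀ q ∈ Ioo a b, p ≤ q →
        ‖f q - f p‖ₑ ≤ ∫⁻ t in Ioc a b, ‖deriv f t‖ₑ := fun p hp q hq hpq => by
      have hsub : Icc p q ⊆ Ioo a b := Icc_subset_Ioo hp.1 hq.2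
      obtain ⟨C, hC⟩ := LocallyLipschitzOn.exists_lipschitzOnWith_of_compact isCompact_Icc
        (hf.mono (by simpa using hsub) : LocallyLipschitzOn (Icc p q) f)
      rw [← uIcc_of_le hpq] at hC
      rw [← hC.absolutelyContinuousOnInterval.integral_deriv_eq_sub,
        intervalIntegral.integral_of_le hpq]
      exact (enorm_integral_le_lintegral_enorm _).trans
        (lintegral_mono_set (Ioc_subset_Ioc hp.1.le hq.2.le))
    have ha : Tendsto f (𝓝[>] a) (𝓝 (f a)) :=
      ((hc a (left_mem_Icc.2 hab)).mono Ioo_subset_Icc_self).tendsto.mono_left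
        (nhdsWithin_Ioo_eq_nhdsGT hab').ge
    have hb : Tendsto f (𝓝[<] b) (𝓝 (f b)) :=
      ((hc b (right_mem_Icc.2 hab)).mono Ioo_subset_Icc_self).tendsto.mono_left
        (nhdsWithin_Ioo_eq_nhdsLT hab').ge
    have hp : ∀ p ∈ Ioo a b, ‖f b - f p‖ₑ ≤ ∫⁻ t in Ioc a b, ‖deriv f t‖ₑ := fun p hp => by
      refine le_of_tendsto (hb.sub_const _).enorm ?_
      filter_upwards [Ioo_mem_nhdsLT hp.2] with q hq
      exact key p hp q ⟨hp.1.trans hq.1, hq.2⟩ hq.1.le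
    refine le_of_tendsto (ha.const_sub _).enorm ?_
    filter_upwards [Ioo_mem_nhdsGT hab'] with p hp'
    exact hp p hp'
  | insert p S _ ih =>
    by_cases hp : p ∈ Ioo a b
    · have h₁ := ih hp.1.le (hc.mono (Icc_subset_Icc_right hp.2.le)) (hf.mono fun t ht =>
        ⟨⟨ht.1.1, ht.1.2.trans hp.2⟩, by simpa [ht.1.2.ne] using ht.2⟩)
      have h₂ := ih hp.2.le (hc.mono (Icc_subset_Icc_left hp.1.le)) (hf.mono fun t ht =>
        ⟨⟨hp.1.trans ht.1.1, ht.1.2⟩, by simpa [ht.1.1.ne'] using ht.2⟩)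
      rw [← Ioc_union_Ioc_eq_Ioc hp.1.le hp.2.le,
        lintegral_union measurableSet_Ioc (Ioc_disjoint_Ioc_of_le le_rfl)]
      calc ‖f b - f a‖ₑ = ‖(f p - f a) + (f b - f p)‖ₑ := by congr 1; ring
        _ ≤ _ := (enorm_add_le _ _).trans (add_le_add h₁ h₂)
    · exact ih hab hc (hf.mono fun t ht => ⟨ht.1, by
        have : t ≠ p := fun h => hp (h ▸ ht.1)
        simpa [this] using ht.2⟩)

/-- A curve crossing an annulus around `x` on which `K` is at least `c` has `K`-length at least `c`
times the width of the annulus. -/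
theorem ofReal_mul_sub_le_KLength {X : Type*} [MetricSpace X] {K : X → ℝ} {x : X} {r₁ r₂ c : ℝ}
    (hr : r₁ < r₂) (hc : 0 ≤ c) (hK : ∀ z, r₁ ≤ dist x z → dist x z ≤ r₂ → c ≤ K z)
    {γ : ℝ → X} {I : Set ℝ} (hγ : PiecewiseLocLipOn γ I) (hI : I.OrdConnected) {s t : ℝ}
    (hs : s ∈ I) (ht : t ∈ I) (hs₁ : dist x (γ s) = r₁) (ht₂ : dist x (γ t) = r₂) :
    ENNReal.ofReal (c * (r₂ - r₁)) ≤ KLength K γ I := by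
  obtain ⟨hcont, S, hS⟩ := hγ
  let φ : X → ℝ := fun z => max r₁ (min r₂ (dist x z))
  have hφ : LipschitzWith 1 φ := ((LipschitzWith.dist_right x).const_min r₂).const_max r₁
  let h : ℝ → ℝ := φ ∘ γ
  have hle : min s t ≤ max s t := min_le_max
  have hIcc : Icc (min s t) (max s t) ⊆ I := hI.uIcc_subset hs ht
  have hIoo : Ioo (min s t) (max s t) ⊆ I := Ioo_subset_Icc_self.trans hIcc
  have hhs : h s = r₁ := by simp [h, φ, hs₁, hr.le]
  have hht : h t = r₂ := by simp [h, φ, ht₂, hr.le]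
  have hend : ‖h (max s t) - h (min s t)‖ₑ = ENNReal.ofReal (r₂ - r₁) := by
    rw [← ofReal_norm, Real.norm_eq_abs]
    rcases le_total s t with hst | hst
    · rw [max_eq_right hst, min_eq_left hst, hhs, hht, abs_of_pos (sub_pos.2 hr)]
    · rw [max_eq_left hst, min_eq_right hst, hhs, hht, abs_sub_comm, abs_of_pos (sub_pos.2 hr)]
  have hloc : LocallyLipschitzOn (Ioo (min s t) (max s t) \ S) h := fun u hu => by
    obtain ⟨ε, hε, C, hC⟩ := hS u ⟨hIoo hu.1, hu.2⟩
    refine ⟨1 * C, _, inter_mem_nhdsWithin _ (Metric.ball_mem_nhds u hε), ?_⟩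
    exact hφ.comp_lipschitzOnWith
      (hC.mono (inter_subset_inter_left _ (sdiff_le_sdiff_right hIoo)))
  have hvar := enorm_sub_le_lintegral_enorm_deriv S hle
    (hφ.continuous.comp_continuousOn (hcont.mono hIcc)) hloc
  rw [hend] at hvar
  calc ENNReal.ofReal (c * (r₂ - r₁)) = ENNReal.ofReal c * ENNReal.ofReal (r₂ - r₁) :=
        ENNReal.ofReal_mul hc
    _ ≤ ENNReal.ofReal c * ∫⁻ u in Ioc (min s t) (max s t), ‖deriv h u‖ₑ := by gcongr
    _ = ∫⁻ u in Ioc (min s t) (max s t), ENNReal.ofReal c * ‖deriv h u‖ₑ :=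
        (lintegral_const_mul _ (measurable_deriv h).enorm).symm
    _ = ∫⁻ u in Ioo (min s t) (max s t), ENNReal.ofReal c * ‖deriv h u‖ₑ := by
        rw [restrict_Ioo_eq_restrict_Ioc]
    _ ≤ ∫⁻ u in Ioo (min s t) (max s t),
          ENNReal.ofReal (K (γ u) * metricDerivWithin γ I u) := ?_
    _ ≤ KLength K γ I := lintegral_mono_set hIoo
  refine lintegral_mono_ae ((ae_restrict_iff' measurableSet_Ioo).2 ?_)
  filter_upwards [hS.ae_exists_hasMetricDerivWithinAt hIoo] with u hu huI
  have hex := hu huI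
  have hInhds : I ∈ 𝓝 u := mem_of_superset (isOpen_Ioo.mem_nhds huI) hIoo
  have hM : HasMetricDerivWithinAt γ I u (metricDerivWithin γ I u) := by
    rw [metricDerivWithin, dif_pos hex]
    exact hex.choose_spec
  have hM' : Tendsto (fun v => dist (γ v) (γ u) / |v - u|) (𝓝[≠] u)
      (𝓝 (metricDerivWithin γ I u)) := by
    refine hM.mono_left (le_of_eq ?_)
    rw [sdiff_eq, inter_comm, nhdsWithin_inter_of_mem' (mem_nhdsWithin_of_mem_nhds hInhds)]
  by_cases hd : deriv h u = 0
  · simp [hd]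
  have hdist : ContinuousAt (fun v => dist x (γ v)) u :=
    continuousAt_const.dist (hcont.continuousAt hInhds)
  have h₁ : r₁ ≤ dist x (γ u) := by
    by_contra! hlt
    refine hd ?_
    have : h =ᶠ[𝓝 u] fun _ => r₁ := by
      filter_upwards [hdist.eventually_lt_const hlt] with v hv
      exact max_eq_left ((min_le_right _ _).trans hv.le)
    rw [this.deriv_eq, deriv_const]
  have h₂ : dist x (γ u) ≤ r₂ := by
    by_contra! hlt
    refine hd ?_
    have : h =ᶠ[𝓝 u] fun _ => max r₁ r₂ := by
      filter_upwards [hdist.eventually_const_lt hlt] with v hv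
      simp [h, φ, min_eq_left hv.le]
    rw [this.deriv_eq, deriv_const]
  have hderiv : ‖deriv h u‖ ≤ metricDerivWithin γ I u := by
    have hslope := (hasDerivAt_iff_tendsto_slope.1
      (differentiableAt_of_deriv_ne_zero hd).hasDerivAt).norm
    refine le_of_tendsto_of_tendsto' hslope hM' fun v => ?_
    rw [slope_def_field, norm_div, Real.norm_eq_abs (v - u), ← dist_eq_norm]
    gcongr
    simpa [h] using hφ.dist_le_mul (γ v) (γ u)
  rw [← ofReal_norm, ← ENNReal.ofReal_mul hc]
  exact ENNReal.ofReal_le_ofReal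
    (mul_le_mul (hK _ h₁ h₂) hderiv (norm_nonneg _) (hc.trans (hK _ h₁ h₂)))

theorem leftEndFilter_le_principal (I : Set ℝ) : leftEndFilter I ≤ 𝓟 I := by
  unfold leftEndFilter
  split_ifs
  exacts [inf_le_right, inf_le_right]

theorem rightEndFilter_le_principal (I : Set ℝ) : rightEndFilter I ≤ 𝓟 I := by
  unfold rightEndFilter
  split_ifs
  exacts [inf_le_right, inf_le_right]

theorem frequently_leftEndFilter_le {I : Set ℝ} {t : ℝ} (ht : t ∈ I) :
    ∃ᶠ s in leftEndFilter I, s ∈ I ∧ s ≤ t := by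
  unfold leftEndFilter
  split_ifs with hb
  · rcases (csInf_le hb ht).eq_or_lt with heq | hlt
    · rw [heq]
      exact fun h => (h.self_of_nhdsWithin ht) ⟨ht, le_rfl⟩
    · have := mem_closure_iff_nhdsWithin_neBot.1 (csInf_mem_closure ⟨t, ht⟩ hb)
      refine Eventually.frequently ?_
      filter_upwards [self_mem_nhdsWithin,
        mem_nhdsWithin_of_mem_nhds (Iio_mem_nhds hlt)] with s hs hst
      exact ⟨hs, le_of_lt hst⟩
  · intro h
    rw [eventually_inf_principal, eventually_atBot] at h
    obtain ⟨a, ha⟩ := h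
    obtain ⟨s, hs, hlt⟩ := not_bddBelow_iff.1 hb (min a t)
    exact ha s (hlt.le.trans (min_le_left _ _)) hs ⟨hs, hlt.le.trans (min_le_right _ _)⟩

theorem frequently_rightEndFilter_ge {I : Set ℝ} {t : ℝ} (ht : t ∈ I) :
    ∃ᶠ s in rightEndFilter I, s ∈ I ∧ t ≤ s := by
  unfold rightEndFilter
  split_ifs with hb
  · rcases (le_csSup hb ht).eq_or_lt with heq | hlt
    · rw [← heq]
      exact fun h => (h.self_of_nhdsWithin ht) ⟨ht, le_rfl⟩
    · have := mem_closure_iff_nhdsWithin_neBot.1 (csSup_mem_closure ⟨t, ht⟩ hb)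
      refine Eventually.frequently ?_
      filter_upwards [self_mem_nhdsWithin,
        mem_nhdsWithin_of_mem_nhds (Ioi_mem_nhds hlt)] with s hs hst
      exact ⟨hs, le_of_lt hst⟩
  · intro h
    rw [eventually_inf_principal, eventually_atTop] at h
    obtain ⟨a, ha⟩ := h
    obtain ⟨s, hs, hlt⟩ := not_bddAbove_iff.1 hb (max a t)
    exact ha s ((le_max_left _ _).trans hlt.le) hs ⟨hs, (le_max_right _ _).trans hlt.le⟩

/-- A path from `x` to `y` meets every sphere around `x` of positive radius less than
`dist x y`. -/
theorem IsPathOn.exists_dist_eq {X : Type*} [MetricSpace X] {γ : ℝ → X} {I : Set ℝ} {x y : X}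
    (h : IsPathOn γ I x y) {r : ℝ} (hr : r ∈ Ioo 0 (dist x y)) : ∃ t ∈ I, dist x (γ t) = r := by
  obtain ⟨⟨t, ht⟩, hI, hc, hl, hr'⟩ := h
  have : (leftEndFilter I).NeBot := ⟨fun h => frequently_leftEndFilter_le ht (h ▸ eventually_bot)⟩
  have : (rightEndFilter I).NeBot := ⟨fun h => frequently_rightEndFilter_ge ht (h ▸ eventually_bot)⟩
  refine hI.isPreconnected.intermediate_value_Ioo (leftEndFilter_le_principal I)
    (rightEndFilter_le_principal I) (f := fun t => dist x (γ t)) (by fun_prop)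
    ?_ (tendsto_const_nhds.dist hr') hr
  simpa using (tendsto_const_nhds (x := x)).dist hl

/-- The length of a path through a point bounds the sum of its distances to the endpoints. -/
theorem IsPathOn.edist_add_edist_le {X : Type*} [MetricSpace X] {γ : ℝ → X} {I : Set ℝ} {x y : X}
    (h : IsPathOn γ I x y) {t : ℝ} (ht : t ∈ I) :
    edist x (γ t) + edist (γ t) y ≤ eVariationOn γ I := by
  have key : ∀ s ∈ I, s ≤ t → ∀ u ∈ I, t ≤ u →
      edist (γ s) (γ t) + edist (γ t) (γ u) ≤ eVariationOn γ I := fun s hs hst u hu htu =>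
    calc edist (γ s) (γ t) + edist (γ t) (γ u)
        ≤ eVariationOn γ (I ∩ Iic t) + eVariationOn γ (I ∩ Ici t) :=
          add_le_add (eVariationOn.edist_le γ ⟨hs, hst⟩ ⟨ht, mem_Iic.2 le_rfl⟩)
            (eVariationOn.edist_le γ ⟨ht, mem_Ici.2 le_rfl⟩ ⟨hu, htu⟩)
      _ ≤ eVariationOn γ ((I ∩ Iic t) ∪ (I ∩ Ici t)) :=
          eVariationOn.add_le_union γ fun _ hp _ hq => (mem_Iic.1 hp.2).trans hq.2
      _ ≤ eVariationOn γ I := eVariationOn.mono γ (union_subset inter_subset_left inter_subset_left)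
  have hleft : ∀ u ∈ I, t ≤ u → edist x (γ t) + edist (γ t) (γ u) ≤ eVariationOn γ I :=
    fun u hu htu => (isClosed_le (f := fun z => edist z (γ t) + edist (γ t) (γ u))
      (by fun_prop) continuous_const).mem_of_frequently_of_tendsto
      ((frequently_leftEndFilter_le ht).mono fun s hs => key s hs.1 hs.2 u hu htu) h.2.2.2.1
  exact (isClosed_le (f := fun z => edist x (γ t) + edist (γ t) z)
      (by fun_prop) continuous_const).mem_of_frequently_of_tendsto
      ((frequently_rightEndFilter_ge ht).mono fun u hu => hleft u hu.1 hu.2) h.2.2.2.2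

/-- In a proper length space, points at distance at most `a + b` admit an intermediate point. -/
theorem IsLengthSpace.exists_dist_le_dist_le {X : Type*} [MetricSpace X] [ProperSpace X]
    (hlen : IsLengthSpace X) {x y : X} {a b : ℝ} (ha : 0 ≤ a) (hb : 0 ≤ b)
    (hxy : dist x y ≤ a + b) : ∃ z, dist x z ≤ a ∧ dist z y ≤ b := by
  rcases le_or_gt (dist x y) a with hle | hlt
  · exact ⟨y, hle, by simpa using hb⟩
  rcases ha.eq_or_lt with rfl | ha
  · exact ⟨x, by simp, by simpa using hxy⟩
  have happrox : ∀ η > 0, ∃ z ∈ Metric.sphere x a, dist z y ≤ b + η := fun η hη => by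
    have hlt' : geodDist x y < ENNReal.ofReal (a + b + η) := by
      rw [hlen, edist_dist]
      exact (ENNReal.ofReal_lt_ofReal_iff (by positivity)).2 (by linarith)
    simp only [geodDist, iInf_lt_iff] at hlt'
    obtain ⟨γ, I, hpath, hvar⟩ := hlt'
    obtain ⟨t, ht, hta⟩ := hpath.exists_dist_eq ⟨ha, hlt⟩
    have hsum := (hpath.edist_add_edist_le ht).trans_lt hvar
    rw [edist_dist, edist_dist, ← ENNReal.ofReal_add dist_nonneg dist_nonneg,
      ENNReal.ofReal_lt_ofReal_iff (by positivity), hta] at hsum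
    exact ⟨γ t, Metric.mem_sphere'.2 hta, by linarith⟩
  obtain ⟨w, hw, -⟩ := happrox 1 one_pos
  obtain ⟨z, hz, hmin⟩ := (isCompact_sphere x a).exists_isMinOn ⟨w, hw⟩
    (f := fun z => dist z y) (by fun_prop)
  refine ⟨z, (Metric.mem_sphere'.1 hz).le, le_of_forall_pos_le_add fun η hη => ?_⟩
  obtain ⟨v, hv, hvb⟩ := happrox η hη
  exact (hmin hv).trans hvb

/-- In a proper length space, points at distance at most `L` are joined by a `1`-Lipschitz
function on any finite subset of `[0, L]`. -/
theorem IsLengthSpace.exists_lipschitz_on_finset {X : Type*} [MetricSpace X] [ProperSpace X]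
    (hlen : IsLengthSpace X) {x y : X} {L : ℝ} (hL : 0 < L) (hxy : dist x y ≤ L) (S : Finset ℝ)
    (hS : ∀ t ∈ S, t ∈ Icc 0 L) :
    ∃ f : ℝ → X, f 0 = x ∧ f L = y ∧
      ∀ p ∈ insert 0 (insert L S), ∀ q ∈ insert 0 (insert L S), p ≤ q →
        dist (f p) (f q) ≤ q - p := by
  induction S using Finset.induction_on with
  | empty =>
    refine ⟨fun t => if t = 0 then x else y, by simp, by simp [hL.ne'], ?_⟩
    simp [hL.ne', hL.not_ge, hL.le, hxy]
  | insert t S htS ih =>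
    obtain ⟨f, hf0, hfL, hf⟩ := ih fun p hp => hS p (Finset.mem_insert_of_mem hp)
    have htI := hS t (Finset.mem_insert_self t S)
    by_cases htT : t ∈ insert 0 (insert L S)
    · refine ⟨f, hf0, hfL, fun p hp q hq => hf p ?_ q ?_⟩
      · simp only [Finset.mem_insert] at hp htT ⊢
        grind
      · simp only [Finset.mem_insert] at hq htT ⊢
        grind
    have ht0 : t ≠ 0 := fun h => htT (by simp [h])
    have htL : t ≠ L := fun h => htT (by simp [h])
    set T : Finset ℝ := insert 0 (insert L S) with hT
    have h0 : (0 : ℝ) ∈ T.filter (· < t) := by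
      simp [hT, htI.1.lt_of_ne' ht0]
    have hLm : L ∈ T.filter (t < ·) := by
      simp [hT, htI.2.lt_of_ne htL]
    obtain ⟨a, ha, hamax⟩ := (T.filter (· < t)).exists_max_image id ⟨0, h0⟩
    obtain ⟨b, hb, hbmin⟩ := (T.filter (t < ·)).exists_min_image id ⟨L, hLm⟩
    simp only [Finset.mem_filter, id] at ha hb hamax hbmin
    obtain ⟨z, hza, hzb⟩ := hlen.exists_dist_le_dist_le (sub_nonneg.2 ha.2.le)
      (sub_nonneg.2 hb.2.le) (x := f a) (y := f b)
      (by linarith [hf a ha.1 b hb.1 (ha.2.trans hb.2).le])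
    have hlow : ∀ p ∈ T, p ≤ t → dist (f p) z ≤ t - p := fun p hp hpt => by
      have hpa := hamax p ⟨hp, hpt.lt_of_ne fun h => htT (h ▸ hp)⟩
      linarith [dist_triangle (f p) (f a) z, hf p hp a ha.1 hpa]
    have hupp : ∀ p ∈ T, t ≤ p → dist z (f p) ≤ p - t := fun p hp hpt => by
      have hpb := hbmin p ⟨hp, hpt.lt_of_ne' fun h => htT (h ▸ hp)⟩
      linarith [dist_triangle z (f b) (f p), hf b hb.1 p hp hpb]
    have hmem : ∀ p ∈ insert 0 (insert L (insert t S)), p = t ∨ (p ≠ t ∧ p ∈ T) := fun p hp => by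
      simp only [hT, Finset.mem_insert] at hp ⊢
      tauto
    refine ⟨Function.update f t z, by simp [Function.update_of_ne ht0.symm, hf0],
      by simp [Function.update_of_ne htL.symm, hfL], fun p hp q hq hpq => ?_⟩
    rcases hmem p hp with rfl | ⟨hpt, hpT⟩ <;> rcases hmem q hq with rfl | ⟨hqt, hqT⟩
    · simp
    · simpa [hqt] using hupp q hqT hpq
    · simpa [hpt] using hlow p hpT hpq
    · simpa [hpt, hqt] using hf p hpT q hqT hpq

/-- In a proper length space, points at distance at most `L` are joined by a `1`-Lipschitz curve
defined on `[0, L]`. -/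
theorem IsLengthSpace.exists_lipschitzOnWith {X : Type*} [MetricSpace X] [ProperSpace X]
    (hlen : IsLengthSpace X) {x y : X} {L : ℝ} (hL : 0 < L) (hxy : dist x y ≤ L) :
    ∃ f : ℝ → X, f 0 = x ∧ f L = y ∧ LipschitzOnWith 1 f (Icc 0 L) := by
  let A : Finset ℝ → Set (ℝ → X) := fun S =>
    (univ.pi fun _ => Metric.closedBall x L) ∩ ({f | f 0 = x} ∩ ({f | f L = y} ∩
      ⋂ p ∈ S, ⋂ q ∈ S, {f | p ∈ Icc 0 L → q ∈ Icc 0 L → p ≤ q → dist (f p) (f q) ≤ q - p}))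
  have hpair : ∀ p q : ℝ, IsClosed
      {f : ℝ → X | p ∈ Icc 0 L → q ∈ Icc 0 L → p ≤ q → dist (f p) (f q) ≤ q - p} := fun p q => by
    simp only [ofPred_forall]
    exact isClosed_iInter fun _ => isClosed_iInter fun _ => isClosed_iInter fun _ =>
      isClosed_le (by fun_prop) continuous_const
  have hclosed : ∀ S, IsClosed (A S) := fun S =>
    (isClosed_set_pi fun _ _ => Metric.isClosed_closedBall).inter <|
      (isClosed_eq (by fun_prop) continuous_const).inter <|
        (isClosed_eq (by fun_prop) continuous_const).inter <|
          isClosed_biInter fun p _ => isClosed_biInter fun q _ => hpair p q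
  have hcompact : ∀ S, IsCompact (A S) := fun S =>
    (isCompact_univ_pi fun _ => isCompact_closedBall x L).of_isClosed_subset (hclosed S)
      inter_subset_left
  have hanti : Antitone A := fun S T hST =>
    inter_subset_inter_right _ <| inter_subset_inter_right _ <| inter_subset_inter_right _ <|
      (biInter_subset_biInter_left (t := fun p => ⋂ q ∈ T, {f : ℝ → X | p ∈ Icc 0 L →
        q ∈ Icc 0 L → p ≤ q → dist (f p) (f q) ≤ q - p}) hST).trans
        (iInter₂_mono fun p _ => biInter_subset_biInter_left hST)
  have hne : ∀ S, (A S).Nonempty := fun S => by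
    obtain ⟨f, hf0, hfL, hf⟩ := hlen.exists_lipschitz_on_finset hL hxy
      (S.filter (· ∈ Icc 0 L)) fun t ht => (Finset.mem_filter.1 ht).2
    set T := insert 0 (insert L (S.filter (· ∈ Icc 0 L))) with hT
    have h0T : 0 ∈ T := by simp [hT]
    have hLT : L ∈ T := by simp [hT]
    have hTI : ∀ t ∈ T, t ∈ Icc 0 L := fun t ht => by
      simp only [hT, Finset.mem_insert, Finset.mem_filter] at ht
      rcases ht with rfl | rfl | ht
      exacts [⟨le_rfl, hL.le⟩, ⟨hL.le, le_rfl⟩, ht.2]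
    refine ⟨fun t => if t ∈ T then f t else x, fun t _ => ?_, by simp [h0T, hf0],
      by simp [hLT, hfL], ?_⟩
    · by_cases ht : t ∈ T
      · have := hf 0 h0T t ht (hTI t ht).1
        rw [hf0] at this
        simpa [ht, dist_comm] using this.trans (by linarith [(hTI t ht).2])
      · simpa [ht] using hL.le
    · simp only [mem_iInter]
      intro p hp q hq hpI hqI hpq
      have hpT : p ∈ T := by simp only [hT, Finset.mem_insert, Finset.mem_filter]; tauto
      have hqT : q ∈ T := by simp only [hT, Finset.mem_insert, Finset.mem_filter]; tauto
      simpa [hpT, hqT] using hf p hpT q hqT hpq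
  obtain ⟨f, hf⟩ := IsCompact.nonempty_iInter_of_directed_nonempty_isCompact_isClosed A
    hanti.directed_ge hne hcompact hclosed
  rw [mem_iInter] at hf
  refine ⟨f, (hf ∅).2.1, (hf ∅).2.2.1, LipschitzOnWith.of_dist_le_mul ?_⟩
  have key : ∀ p ∈ Icc 0 L, ∀ q ∈ Icc 0 L, p ≤ q → dist (f p) (f q) ≤ q - p :=
    fun p hp q hq hpq => by
      have := (hf {p, q}).2.2.2
      simp only [mem_iInter] at this
      exact this p (by simp) q (by simp) hp hq hpq
  intro p hp q hq
  rw [NNReal.coe_one, one_mul, Real.dist_eq]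
  rcases le_total p q with hpq | hpq
  · rw [abs_sub_comm]
    exact (key p hp q hq hpq).trans (le_abs_self _)
  · rw [dist_comm]
    exact (key q hq p hp hpq).trans (le_abs_self _)

/-- The metric derivative of a `C`-Lipschitz curve is at most `C`. -/
theorem LipschitzOnWith.metricDerivWithin_le {X : Type*} [MetricSpace X] {γ : ℝ → X} {I : Set ℝ}
    {C : ℝ≥0} (hγ : LipschitzOnWith C γ I) {t : ℝ} (ht : t ∈ I) [(𝓝[I \ {t}] t).NeBot] :
    metricDerivWithin γ I t ≤ C := by
  unfold metricDerivWithin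
  split_ifs with h
  · refine le_of_tendsto h.choose_spec ?_
    filter_upwards [self_mem_nhdsWithin] with s hs
    exact div_le_of_le_mul₀ (abs_nonneg _) C.2 (hγ.dist_le_mul s hs.1 t ht)
  · exact C.2

/-- In a proper length space, `d_K(x, y) ≤ M L` if `dist x y ≤ L` and `K ≤ M` on the ball of
radius `L` around `x`. -/
theorem IsLengthSpace.dK_le {X : Type*} [MetricSpace X] [ProperSpace X] (hlen : IsLengthSpace X)
    {K : X → ℝ} {x y : X} {L M : ℝ} (hL : 0 < L) (hxy : dist x y ≤ L) (hK0 : ∀ z, 0 ≤ K z)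
    (hK : ∀ z ∈ Metric.closedBall x L, K z ≤ M) : dK K x y ≤ ENNReal.ofReal (M * L) := by
  have hM : 0 ≤ M := (hK0 x).trans (hK x (Metric.mem_closedBall_self hL.le))
  obtain ⟨f, hf0, hfL, hf⟩ := hlen.exists_lipschitzOnWith hL hxy
  have hcont := hf.continuousOn
  have hpl : PiecewiseLocLipOn f (Icc 0 L) :=
    ⟨hcont, ∅, fun t _ => ⟨1, one_pos, 1, hf.mono fun s hs => hs.1.1⟩⟩
  have hpath : IsPathOn f (Icc 0 L) x y := by
    refine ⟨⟨0, left_mem_Icc.2 hL.le⟩, ordConnected_Icc, hcont, ?_, ?_⟩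
    · rw [leftEndFilter, if_pos bddBelow_Icc, csInf_Icc hL.le, ← hf0]
      exact hcont 0 (left_mem_Icc.2 hL.le)
    · rw [rightEndFilter, if_pos bddAbove_Icc, csSup_Icc hL.le, ← hfL]
      exact hcont L (right_mem_Icc.2 hL.le)
  calc dK K x y ≤ KLength K f (Icc 0 L) :=
        iInf_le_of_le f (iInf_le_of_le _ (iInf_le_of_le hpl (iInf_le _ hpath)))
    _ ≤ ∫⁻ _ in Icc 0 L, ENNReal.ofReal M := ?_
    _ = ENNReal.ofReal (M * L) := by
        rw [setLIntegral_const, Real.volume_Icc, sub_zero, ENNReal.ofReal_mul hM]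
  refine setLIntegral_mono measurable_const fun t ht => ENNReal.ofReal_le_ofReal ?_
  have := accPt_principal_iff_nhdsWithin.1 (uniqueDiffOn_Icc hL t ht).accPt
  have hft : f t ∈ Metric.closedBall x L := by
    have := hf.dist_le_mul t ht 0 (left_mem_Icc.2 hL.le)
    rw [hf0, NNReal.coe_one, one_mul, Real.dist_0_eq_abs, abs_of_nonneg ht.1] at this
    exact this.trans ht.2
  calc K (f t) * metricDerivWithin f (Icc 0 L) t ≤ K (f t) * 1 := by
        gcongr
        exacts [hK0 _, hf.metricDerivWithin_le ht]
    _ ≤ M := (mul_one _).trans_le (hK _ hft)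

/-- Under hypotheses (H1)-(H3), on every `d`-compact subset `Y ⊆ X` the metrics
`d` and `d_K` are topologically equivalent: the identity map from `(Y, d)` to `(Y, d_K)` is
continuous with continuous inverse. -/
theorem dK_equivalent_on_compacts
    {X : Type*} [MetricSpace X] [ProperSpace X] (hlen : IsLengthSpace X)
    (K : X → ℝ) (hKc : Continuous K) (hK0 : ∀ x, 0 ≤ K x)
    (hfin : {x : X | K x = 0}.Finite)
    (k : ℝ → ℝ) (hkc : ContinuousOn k (Set.Ici 0)) (hk0 : ∀ t ∈ Set.Ici (0 : ℝ), 0 ≤ k t)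
    (hkdiv : ∫⁻ t in Set.Ioi (0 : ℝ), ENNReal.ofReal (k t) = ⊤)
    (hlow : ∀ x : X, k (Metric.infDist x {x : X | K x = 0}) ≤ K x) :
    ∀ Y : Set X, IsCompact Y →
      (∀ x ∈ Y, ∀ ε : ℝ≥0∞, 0 < ε → ∃ δ > (0 : ℝ), ∀ y ∈ Y, dist x y < δ → dK K x y < ε) ∧
      (∀ x ∈ Y, ∀ ε > (0 : ℝ), ∃ δ : ℝ≥0∞, 0 < δ ∧ ∀ y ∈ Y, dK K x y < δ → dist x y < ε) := by
  intro Y _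
  refine ⟨fun x _ ε hε => ?_, fun x _ ε hε => ?_⟩
  · have hlim : Tendsto (fun δ : ℝ => ENNReal.ofReal ((K x + 1) * δ)) (𝓝[>] 0) (𝓝 0) := by
      have : Continuous fun δ : ℝ => ENNReal.ofReal ((K x + 1) * δ) :=
        ENNReal.continuous_ofReal.comp (by fun_prop)
      simpa using (this.tendsto 0).mono_left nhdsWithin_le_nhds
    obtain ⟨r, hr, hball⟩ := Metric.nhds_basis_closedBall.eventually_iff.1
      (hKc.continuousAt.eventually_le_const (lt_add_one (K x)))
    obtain ⟨δ, hδε, hδ⟩ :=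
      ((hlim.eventually_lt_const hε).and (Ioo_mem_nhdsGT hr)).exists
    exact ⟨δ, hδ.1, fun y _ hxy => (hlen.dK_le hδ.1 hxy.le hK0
      fun z hz => hball (Metric.closedBall_subset_closedBall hδ.2.le hz)).trans_lt hδε⟩
  · have hD : ((fun z => dist x z) '' {z | K z = 0}).Finite := hfin.image _
    obtain ⟨r, hr⟩ := ((Ioo_infinite hε).sdiff hD).nonempty
    have hopen : IsOpen (Ioo 0 ε \ (fun z => dist x z) '' {z | K z = 0}) :=
      isOpen_Ioo.sdiff hD.isClosed
    obtain ⟨η, hη, hsub⟩ := Metric.nhds_basis_closedBall.mem_iff.1 (hopen.mem_nhds hr)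
    rw [Real.closedBall_eq_Icc] at hsub
    have hlt : r - η < r + η := by linarith
    have hcomp : IsCompact {z | dist x z ∈ Icc (r - η) (r + η)} :=
      (isCompact_closedBall x (r + η)).of_isClosed_subset
        (isClosed_Icc.preimage (by fun_prop : Continuous fun z => dist x z))
        fun z hz => Metric.mem_closedBall'.2 hz.2
    obtain ⟨c, hc, hcK⟩ := hcomp.exists_forall_le' hKc.continuousOn (a := 0) fun z hz =>
      (hK0 z).lt_of_ne fun h0 => (hsub hz).2 ⟨z, h0.symm, rfl⟩
    refine ⟨ENNReal.ofReal (c * (r + η - (r - η))),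
      ENNReal.ofReal_pos.2 (mul_pos hc (sub_pos.2 hlt)), fun y _ hy => ?_⟩
    by_contra! hxy
    refine hy.not_ge (le_iInf fun γ => le_iInf fun I => le_iInf fun hγ => le_iInf fun hpath => ?_)
    have hradius : ∀ p ∈ Icc (r - η) (r + η), p ∈ Ioo 0 (dist x y) := fun p hp =>
      ⟨(hsub hp).1.1, (hsub hp).1.2.trans_le hxy⟩
    obtain ⟨s, hs, hs₁⟩ := hpath.exists_dist_eq (hradius _ (left_mem_Icc.2 hlt.le))
    obtain ⟨t, ht, ht₂⟩ := hpath.exists_dist_eq (hradius _ (right_mem_Icc.2 hlt.le))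
    exact ofReal_mul_sub_le_KLength hlt hc.le (fun z h₁ h₂ => hcK z ⟨h₁, h₂⟩) hγ hpath.2.1
      hs ht hs₁ ht₂
end
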